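/- arXiv:2004.10284 — 2 statements merged into one kernel-verified Lean document; each statement's English description precedes it below -/
import Mathlib

section
/- Let R > 0 and κ = 1/R, and let α : ℝ → ℝ be twice differentiable with α''(s) = −2·sin³(α(s))·cos(α(s))/R², 0 < α(0) < π/2 and α'(0) = √(1 − sin⁴(α(0)))/R > 0. Then α(s) < π/2 for all s ∈ ℝ (the solution never reaches π/2 in finite time), and lim_{s→∞} α(s) = π/2; hence the corresponding curve on the cylinder spirals asymptotically towards a circle-latitude. -/
open Filter

/-- A function whose logarithmic derivative is bounded keeps its sign. -/
theorem pos_of_abs_deriv_le_mul_abs {f f' : ℝ → ℝ} {K a : ℝ}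
    (hf : ∀ s, HasDerivAt f (f' s) s) (hb : ∀ s, |f' s| ≤ K * |f s|) (ha : 0 < f a) (s : ℝ) :
    0 < f s := by
  have hexp (c t : ℝ) : HasDerivAt (fun t => f t ^ 2 * Real.exp (c * t))
      ((2 * (f t * f' t) + c * f t ^ 2) * Real.exp (c * t)) t := by
    have h := ((hf t).pow 2).mul ((hasDerivAt_id t).const_mul c).exp
    refine h.congr_deriv ?_
    simp
    ring
  have hmul (t : ℝ) : |f t * f' t| ≤ K * f t ^ 2 := by
    rw [abs_mul, ← sq_abs (f t)]
    nlinarith [hb t, abs_nonneg (f t)]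
  have hmono : Monotone fun t => f t ^ 2 * Real.exp (2 * K * t) :=
    monotone_of_hasDerivAt_nonneg (hexp (2 * K)) fun t =>
      mul_nonneg (by linarith [(abs_le.mp (hmul t)).1]) (Real.exp_pos _).le
  have hanti : Antitone fun t => f t ^ 2 * Real.exp (-2 * K * t) :=
    antitone_of_hasDerivAt_nonpos (hexp (-2 * K)) fun t =>
      mul_nonpos_of_nonpos_of_nonneg (by linarith [(abs_le.mp (hmul t)).2]) (Real.exp_pos _).le
  have hne (t : ℝ) : f t ≠ 0 := by
    intro h
    rcases le_total a t with hat | hat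
    · have h1 := hmono hat
      simp only [h] at h1
      have : 0 < f a ^ 2 * Real.exp (2 * K * a) := by positivity
      linarith
    · have h1 := hanti hat
      simp only [h] at h1
      have : 0 < f a ^ 2 * Real.exp (-2 * K * a) := by positivity
      linarith
  by_contra! hs
  have hcont : Continuous f := continuous_iff_continuousAt.mpr fun t => (hf t).continuousAt
  obtain ⟨t, ht⟩ := mem_range_of_exists_le_of_exists_ge hcont ⟨s, hs⟩ ⟨a, ha.le⟩
  exact hne t ht

/-- Conservation of `(α')² + sin⁴(α)/R²` along solutions of the ODE. -/
theorem energy_eq {R : ℝ} {α : ℝ → ℝ} (hα : Differentiable ℝ α)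
    (hα' : Differentiable ℝ (deriv α))
    (hode : ∀ s : ℝ, deriv (deriv α) s =
      -2 * Real.sin (α s) ^ 3 * Real.cos (α s) / R ^ 2) (s t : ℝ) :
    deriv α s ^ 2 + Real.sin (α s) ^ 4 / R ^ 2 = deriv α t ^ 2 + Real.sin (α t) ^ 4 / R ^ 2 := by
  have hd (x : ℝ) :
      HasDerivAt (fun x => deriv α x ^ 2 + Real.sin (α x) ^ 4 / R ^ 2) 0 x := by
    have h := ((hα' x).hasDerivAt.pow 2).add (((hα x).hasDerivAt.sin.pow 4).div_const (R ^ 2))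
    refine h.congr_deriv ?_
    rw [hode]
    simp
    ring
  exact is_const_of_deriv_eq_zero (fun x => (hd x).differentiableAt) (fun x => (hd x).deriv) s t

/-- For `κ = 1/R`, a solution of `α'' = −2·sin³(α)·cos(α)/R²` starting with
`0 < α(0) < π/2` and `α'(0) = √(1 − sin⁴(α(0)))/R > 0` never reaches `π/2` in
finite time and converges to `π/2` as `s → ∞`: the corresponding curve on the
cylinder spirals asymptotically towards a circle-latitude. -/
theorem spirals_to_latitude (R : ℝ) (hR : 0 < R)
    (α : ℝ → ℝ) (hα : Differentiable ℝ α) (hα' : Differentiable ℝ (deriv α))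
    (hode : ∀ s : ℝ, deriv (deriv α) s =
      -2 * Real.sin (α s) ^ 3 * Real.cos (α s) / R ^ 2)
    (h0 : 0 < α 0) (h0' : α 0 < Real.pi / 2)
    (hd0 : deriv α 0 = Real.sqrt (1 - Real.sin (α 0) ^ 4) / R) :
    (∀ s : ℝ, α s < Real.pi / 2) ∧
    Tendsto α atTop (nhds (Real.pi / 2)) := by
  have hE (s : ℝ) : (R * deriv α s) ^ 2 =
      Real.cos (α s) ^ 2 * (1 + Real.sin (α s) ^ 2) := by
    have h1 := energy_eq hα hα' hode s 0
    have h2 : 0 ≤ 1 - Real.sin (α 0) ^ 4 := by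
      nlinarith [Real.sin_sq_le_one (α 0), sq_nonneg (Real.sin (α 0))]
    rw [hd0, div_pow, Real.sq_sqrt h2] at h1
    field_simp at h1
    rw [Real.cos_sq']
    linarith
  have hupper (s : ℝ) : |deriv α s| ≤ 2 / R * |Real.cos (α s)| := by
    have h : |R * deriv α s| ≤ |2 * Real.cos (α s)| := by
      apply sq_le_sq.mp
      rw [hE]
      nlinarith [Real.sin_sq_le_one (α s), sq_nonneg (Real.cos (α s))]
    rw [abs_mul, abs_mul, abs_of_pos hR, abs_two] at h
    rw [div_mul_eq_mul_div, le_div_iff₀ hR]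
    linarith
  have hlower (s : ℝ) : |Real.cos (α s)| ≤ R * |deriv α s| := by
    rw [show R * |deriv α s| = |R * deriv α s| by rw [abs_mul, abs_of_pos hR]]
    apply sq_le_sq.mp
    rw [hE]
    nlinarith [sq_nonneg (Real.sin (α s)), sq_nonneg (Real.cos (α s))]
  have hK : 0 ≤ 2 / R := by positivity
  have hu (s : ℝ) : 0 < Real.pi / 2 - α s := by
    refine pos_of_abs_deriv_le_mul_abs (f := fun s => Real.pi / 2 - α s) (K := 2 / R) (a := 0)
      (fun t => (hα t).hasDerivAt.const_sub _) (fun t => ?_) (by linarith) s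
    rw [abs_neg]
    refine (hupper t).trans (mul_le_mul_of_nonneg_left ?_ hK)
    rw [← Real.sin_pi_div_two_sub]
    exact Real.abs_sin_le_abs
  have hv (s : ℝ) : 0 < α s + Real.pi / 2 := by
    refine pos_of_abs_deriv_le_mul_abs (f := fun s => α s + Real.pi / 2) (K := 2 / R) (a := 0)
      (fun t => (hα t).hasDerivAt.add_const _) (fun t => ?_) (by linarith [Real.pi_pos]) s
    refine (hupper t).trans (mul_le_mul_of_nonneg_left ?_ hK)
    rw [← Real.sin_add_pi_div_two]
    exact Real.abs_sin_le_abs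
  have hcos (s : ℝ) : 0 < Real.cos (α s) :=
    Real.cos_pos_of_mem_Ioo ⟨by linarith [hv s], by linarith [hu s]⟩
  have hpos (s : ℝ) : 0 < deriv α s := by
    refine pos_of_abs_deriv_le_mul_abs (K := 2 / R) (a := 0)
      (fun t => (hα' t).hasDerivAt) (fun t => ?_) ?_ s
    · have hsin : |Real.sin (α t)| ^ 3 ≤ 1 :=
        pow_le_one₀ (abs_nonneg _) (Real.abs_sin_le_one _)
      rw [hode, abs_div, abs_mul, abs_mul, abs_pow, abs_neg, abs_two, abs_of_pos (pow_pos hR 2),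
        div_le_iff₀ (pow_pos hR 2)]
      calc 2 * |Real.sin (α t)| ^ 3 * |Real.cos (α t)|
          ≤ 2 * 1 * (R * |deriv α t|) := by gcongr; exact hlower t
        _ = 2 / R * |deriv α t| * R ^ 2 := by field_simp
    · have h : 0 ≤ deriv α 0 := hd0 ▸ by positivity
      have h1 := hlower 0
      rw [abs_of_pos (hcos 0), abs_of_nonneg h] at h1
      exact pos_of_mul_pos_right ((hcos 0).trans_le h1) hR.le
  have hmono : StrictMono α := strictMono_of_deriv_pos hpos
  refine ⟨fun s => by linarith [hu s], ?_⟩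
  set c : ℝ := 2 / Real.pi / R with hc
  have hc_pos : 0 < c := by positivity
  have hdecay : AntitoneOn (fun s => (Real.pi / 2 - α s) * Real.exp (c * s)) (Set.Ici 0) := by
    have hd (s : ℝ) : HasDerivAt (fun s => (Real.pi / 2 - α s) * Real.exp (c * s))
        ((c * (Real.pi / 2 - α s) - deriv α s) * Real.exp (c * s)) s := by
      have h := ((hα s).hasDerivAt.const_sub (Real.pi / 2)).mul
        ((hasDerivAt_id s).const_mul c).exp
      refine h.congr_deriv ?_
      simp
      ring
    refine antitoneOn_of_deriv_nonpos (convex_Ici 0)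
      (fun s _ => (hd s).continuousAt.continuousWithinAt)
      (fun s _ => (hd s).differentiableAt.differentiableWithinAt) fun s hs => ?_
    rw [interior_Ici, Set.mem_Ioi] at hs
    rw [(hd s).deriv]
    refine mul_nonpos_of_nonpos_of_nonneg ?_ (Real.exp_pos _).le
    have h1 := Real.mul_le_sin (hu s).le (by linarith [hmono hs])
    have h2 := hlower s
    rw [Real.sin_pi_div_two_sub] at h1
    rw [abs_of_pos (hcos s), abs_of_pos (hpos s)] at h2
    rw [hc, div_mul_eq_mul_div, sub_nonpos, div_le_iff₀ hR]
    linarith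
  have hbound : ∀ᶠ s in atTop,
      Real.pi / 2 - α s ≤ (Real.pi / 2 - α 0) * Real.exp (-(c * s)) := by
    filter_upwards [eventually_ge_atTop 0] with s hs
    have h := hdecay Set.self_mem_Ici hs hs
    simp only [mul_zero, Real.exp_zero, mul_one] at h
    rwa [Real.exp_neg, ← div_eq_mul_inv, le_div_iff₀ (Real.exp_pos _)]
  have hexp : Tendsto (fun s => (Real.pi / 2 - α 0) * Real.exp (-(c * s))) atTop (nhds 0) := by
    simpa using (Real.tendsto_exp_neg_atTop_nhds_zero.comp
      (tendsto_id.const_mul_atTop hc_pos)).const_mul (Real.pi / 2 - α 0)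
  have hlim := squeeze_zero' (Eventually.of_forall fun s => (hu s).le) hbound hexp
  simpa using hlim.const_sub (Real.pi / 2)
end

section
/- Let κ > 0 be a constant, let τ : ℝ → ℝ be continuous, and let c, e₁, e₂, e₃ : ℝ → ℝ³ be differentiable and satisfy c' = e₁ together with the Frenet–Serret equations e₁' = κ·e₂, e₂' = −κ·e₁ − τ·e₃, e₃' = τ·e₂, with (e₁(0), e₂(0), e₃(0)) orthonormal. Fix s₁ ∈ ℝ and suppose τ is symmetric about s₁, i.e. τ(2s₁ − s) = τ(s) for all s. Let ρ : ℝ³ → ℝ³ be the 180° rotation about the line through c(s₁) in direction e₂(s₁), namely ρ(x) = c(s₁) + 2⟨x − c(s₁), e₂(s₁)⟩·e₂(s₁) − (x − c(s₁)). Then c(2s₁ − s) = ρ(c(s)) for all s ∈ ℝ; that is, the curve is symmetric under the 180° rotation around its principal curvature normal at c(s₁). -/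
open scoped RealInnerProductSpace

/-- `(u, v, w)` is an orthonormal triple in `ℝ³`. -/
def OrthoTriple (u v w : EuclideanSpace ℝ (Fin 3)) : Prop :=
  ‖u‖ = 1 ∧ ‖v‖ = 1 ∧ ‖w‖ = 1 ∧ ⟪u, v⟫ = 0 ∧ ⟪u, w⟫ = 0 ∧ ⟪v, w⟫ = 0

section Frenet

variable {E : Type*} [NormedAddCommGroup E] [InnerProductSpace ℝ E]

/-- `(e₁, e₂, e₃)` solves the Frenet–Serret system with curvature `κ` and torsion `τ`. -/
structure IsFrenetSolution (κ : ℝ) (τ : ℝ → ℝ) (e₁ e₂ e₃ : ℝ → E) : Prop where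
  deriv₁ : ∀ s, HasDerivAt e₁ (κ • e₂ s) s
  deriv₂ : ∀ s, HasDerivAt e₂ (-(κ • e₁ s) - τ s • e₃ s) s
  deriv₃ : ∀ s, HasDerivAt e₃ (τ s • e₂ s) s

/-- The squared Frobenius distance of the Gram matrix of `(u, v, w)` from the identity. -/
def gramDefect (u v w : E) : ℝ :=
  (⟪u, u⟫ - 1) ^ 2 + (⟪v, v⟫ - 1) ^ 2 + (⟪w, w⟫ - 1) ^ 2
    + 2 * (⟪u, v⟫ ^ 2 + ⟪u, w⟫ ^ 2 + ⟪v, w⟫ ^ 2)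

/-- A function with vanishing derivative takes the same value everywhere. -/
theorem eq_of_hasDerivAt_zero {f : ℝ → E} (hf : ∀ s, HasDerivAt f 0 s) (s t : ℝ) : f s = f t :=
  is_const_of_deriv_eq_zero (fun x => (hf x).differentiableAt) (fun x => (hf x).deriv) s t

namespace IsFrenetSolution

variable {κ : ℝ} {τ : ℝ → ℝ} {e₁ e₂ e₃ f₁ f₂ f₃ : ℝ → E}

theorem sub (he : IsFrenetSolution κ τ e₁ e₂ e₃) (hf : IsFrenetSolution κ τ f₁ f₂ f₃) :
    IsFrenetSolution κ τ (e₁ - f₁) (e₂ - f₂) (e₃ - f₃) where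
  deriv₁ s := ((he.deriv₁ s).sub (hf.deriv₁ s)).congr_deriv (by simp only [Pi.sub_apply]; module)
  deriv₂ s := ((he.deriv₂ s).sub (hf.deriv₂ s)).congr_deriv (by simp only [Pi.sub_apply]; module)
  deriv₃ s := ((he.deriv₃ s).sub (hf.deriv₃ s)).congr_deriv (by simp only [Pi.sub_apply]; module)

/-- The total squared length of a solution is conserved. -/
theorem sum_inner_self_eq (he : IsFrenetSolution κ τ e₁ e₂ e₃) (s t : ℝ) :
    ⟪e₁ s, e₁ s⟫ + ⟪e₂ s, e₂ s⟫ + ⟪e₃ s, e₃ s⟫ = ⟪e₁ t, e₁ t⟫ + ⟪e₂ t, e₂ t⟫ + ⟪e₃ t, e₃ t⟫ := by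
  refine eq_of_hasDerivAt_zero (f := fun s => ⟪e₁ s, e₁ s⟫ + ⟪e₂ s, e₂ s⟫ + ⟪e₃ s, e₃ s⟫)
    (fun s => ?_) s t
  have h₁ := he.deriv₁ s
  have h₂ := he.deriv₂ s
  have h₃ := he.deriv₃ s
  refine (((h₁.inner ℝ h₁).add (h₂.inner ℝ h₂)).add (h₃.inner ℝ h₃)).congr_deriv ?_
  simp only [inner_sub_left, inner_sub_right, inner_neg_left, inner_neg_right,
    real_inner_smul_left, real_inner_smul_right, real_inner_comm (e₁ s) (e₂ s),
    real_inner_comm (e₂ s) (e₃ s)]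
  ring

/-- Two solutions which agree at one point have the same tangent everywhere. -/
theorem eq_of_eq_at (he : IsFrenetSolution κ τ e₁ e₂ e₃) (hf : IsFrenetSolution κ τ f₁ f₂ f₃)
    {t : ℝ} (h₁ : e₁ t = f₁ t) (h₂ : e₂ t = f₂ t) (h₃ : e₃ t = f₃ t) (s : ℝ) : e₁ s = f₁ s := by
  have h := (he.sub hf).sum_inner_self_eq s t
  simp only [Pi.sub_apply, h₁, h₂, h₃, sub_self,
    real_inner_self_eq_norm_sq, norm_zero] at h
  have h0 : ‖e₁ s - f₁ s‖ ^ 2 = 0 := by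
    linarith [sq_nonneg (‖e₁ s - f₁ s‖), sq_nonneg (‖e₂ s - f₂ s‖), sq_nonneg (‖e₃ s - f₃ s‖)]
  simpa [sub_eq_zero] using h0

/-- The squared distance of the Gram matrix of a solution from the identity is conserved. -/
theorem gramDefect_eq (he : IsFrenetSolution κ τ e₁ e₂ e₃) (s t : ℝ) :
    gramDefect (e₁ s) (e₂ s) (e₃ s) = gramDefect (e₁ t) (e₂ t) (e₃ t) := by
  refine eq_of_hasDerivAt_zero (f := fun s => gramDefect (e₁ s) (e₂ s) (e₃ s)) (fun s => ?_) s t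
  have h₁ := he.deriv₁ s
  have h₂ := he.deriv₂ s
  have h₃ := he.deriv₃ s
  refine ((((((h₁.inner ℝ h₁).sub_const 1).pow 2).add (((h₂.inner ℝ h₂).sub_const 1).pow 2)).add
    (((h₃.inner ℝ h₃).sub_const 1).pow 2)).add (((((h₁.inner ℝ h₂).pow 2).add
      ((h₁.inner ℝ h₃).pow 2)).add ((h₂.inner ℝ h₃).pow 2)).const_mul 2)).congr_deriv ?_
  simp only [inner_sub_left, inner_sub_right, inner_neg_left, inner_neg_right,
    real_inner_smul_left, real_inner_smul_right, real_inner_comm (e₁ s) (e₂ s),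
    real_inner_comm (e₂ s) (e₃ s)]
  push_cast
  ring

/-- Reversing a solution about a symmetry point of the torsion, composing with a linear map and
changing the signs of the first and third vectors gives another solution. -/
theorem reflect (he : IsFrenetSolution κ τ e₁ e₂ e₃) (R : E →L[ℝ] E) {a : ℝ}
    (hτ : ∀ s, τ (a - s) = τ s) :
    IsFrenetSolution κ τ (fun s => -R (e₁ (a - s))) (fun s => R (e₂ (a - s)))
      (fun s => -R (e₃ (a - s))) where
  deriv₁ s := by
    have h := (R.hasFDerivAt.comp_hasDerivAt s ((he.deriv₁ (a - s)).comp_const_sub a s)).neg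
    exact h.congr_deriv (by simp)
  deriv₂ s := by
    have h := R.hasFDerivAt.comp_hasDerivAt s ((he.deriv₂ (a - s)).comp_const_sub a s)
    exact h.congr_deriv (by simp [hτ]; module)
  deriv₃ s := by
    have h := (R.hasFDerivAt.comp_hasDerivAt s ((he.deriv₃ (a - s)).comp_const_sub a s)).neg
    exact h.congr_deriv (by simp [hτ])

end IsFrenetSolution

end Frenet

/-- A solution of the Frenet–Serret system which is orthonormal at one point is orthonormal
everywhere. -/
theorem OrthoTriple.of_isFrenetSolution {κ : ℝ} {τ : ℝ → ℝ}
    {e₁ e₂ e₃ : ℝ → EuclideanSpace ℝ (Fin 3)} (he : IsFrenetSolution κ τ e₁ e₂ e₃) {t : ℝ}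
    (h : OrthoTriple (e₁ t) (e₂ t) (e₃ t)) (s : ℝ) : OrthoTriple (e₁ s) (e₂ s) (e₃ s) := by
  obtain ⟨n₁, n₂, n₃, h₁₂, h₁₃, h₂₃⟩ := h
  have key := he.gramDefect_eq s t
  simp only [gramDefect, real_inner_self_eq_norm_sq, n₁, n₂, n₃, h₁₂, h₁₃, h₂₃] at key
  have p₁ := sq_nonneg (‖e₁ s‖ ^ 2 - 1)
  have p₂ := sq_nonneg (‖e₂ s‖ ^ 2 - 1)
  have p₃ := sq_nonneg (‖e₃ s‖ ^ 2 - 1)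
  have q₁ := sq_nonneg ⟪e₁ s, e₂ s⟫
  have q₂ := sq_nonneg ⟪e₁ s, e₃ s⟫
  have q₃ := sq_nonneg ⟪e₂ s, e₃ s⟫
  have norm_eq_one {x : EuclideanSpace ℝ (Fin 3)} (hx : (‖x‖ ^ 2 - 1) ^ 2 = 0) : ‖x‖ = 1 :=
    (pow_eq_one_iff_of_nonneg (norm_nonneg x) two_ne_zero).mp
      (sub_eq_zero.mp (pow_eq_zero_iff two_ne_zero |>.mp hx))
  exact ⟨norm_eq_one (by linarith), norm_eq_one (by linarith), norm_eq_one (by linarith),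
    pow_eq_zero_iff two_ne_zero |>.mp (by linarith),
    pow_eq_zero_iff two_ne_zero |>.mp (by linarith),
    pow_eq_zero_iff two_ne_zero |>.mp (by linarith)⟩

/-- If the torsion of a constant curvature space curve is symmetric about `s₁`,
i.e. `τ(2s₁ − s) = τ(s)`, then the curve is symmetric under the 180° rotation
`ρ(x) = c(s₁) + 2⟨x − c(s₁), e₂(s₁)⟩·e₂(s₁) − (x − c(s₁))` around its
principal curvature normal at `c(s₁)`: `c(2s₁ − s) = ρ(c(s))`. -/
theorem principal_normal_rotation_symmetry (κ : ℝ) (hκ : 0 < κ) (τ : ℝ → ℝ)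
    (hτ : Continuous τ)
    (c e₁ e₂ e₃ : ℝ → EuclideanSpace ℝ (Fin 3))
    (hc : Differentiable ℝ c) (he₁ : Differentiable ℝ e₁)
    (he₂ : Differentiable ℝ e₂) (he₃ : Differentiable ℝ e₃)
    (hc' : ∀ s : ℝ, deriv c s = e₁ s)
    (hf₁ : ∀ s : ℝ, deriv e₁ s = κ • e₂ s)
    (hf₂ : ∀ s : ℝ, deriv e₂ s = -(κ • e₁ s) - τ s • e₃ s)
    (hf₃ : ∀ s : ℝ, deriv e₃ s = τ s • e₂ s)
    (h0 : OrthoTriple (e₁ 0) (e₂ 0) (e₃ 0))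
    (s₁ : ℝ) (hsymm : ∀ s : ℝ, τ (2 * s₁ - s) = τ s) :
    ∀ s : ℝ, c (2 * s₁ - s) =
      c s₁ + (2 * ⟪c s - c s₁, e₂ s₁⟫) • e₂ s₁ - (c s - c s₁) := by
  have he : IsFrenetSolution κ τ e₁ e₂ e₃ :=
    ⟨fun s => hf₁ s ▸ (he₁ s).hasDerivAt, fun s => hf₂ s ▸ (he₂ s).hasDerivAt,
      fun s => hf₃ s ▸ (he₃ s).hasDerivAt⟩
  obtain ⟨-, n₂, -, h₁₂, -, h₂₃⟩ := h0.of_isFrenetSolution he s₁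
  have hself : ⟪e₂ s₁, e₂ s₁⟫ = 1 := by rw [real_inner_self_eq_norm_sq, n₂, one_pow]
  let R : EuclideanSpace ℝ (Fin 3) →L[ℝ] EuclideanSpace ℝ (Fin 3) :=
    (2 : ℝ) • (innerSL ℝ (e₂ s₁)).smulRight (e₂ s₁) - ContinuousLinearMap.id ℝ _
  have hR (x) : R x = (2 * ⟪x, e₂ s₁⟫) • e₂ s₁ - x := by
    simp [R, smul_smul, real_inner_comm]
  have hs₁ : 2 * s₁ - s₁ = s₁ := by ring
  have htangent (s) : e₁ s = -R (e₁ (2 * s₁ - s)) := by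
    refine he.eq_of_eq_at (he.reflect R hsymm) (t := s₁) ?_ ?_ ?_ s
    · simp [hs₁, hR, h₁₂]
    · simp only [hs₁, hR, hself]
      module
    · simp [hs₁, hR, real_inner_comm, h₂₃]
  have hderiv (s) : HasDerivAt (fun s => c s - R (c (2 * s₁ - s) - c s₁)) 0 s := by
    have hc₁ (s) : HasDerivAt c (e₁ s) s := hc' s ▸ (hc s).hasDerivAt
    have h := (hc₁ s).sub (R.hasFDerivAt.comp_hasDerivAt s
      (((hc₁ (2 * s₁ - s)).comp_const_sub (2 * s₁) s).sub_const (c s₁)))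
    exact h.congr_deriv (by rw [htangent s]; simp)
  intro s
  have h := eq_of_hasDerivAt_zero hderiv (2 * s₁ - s) s₁
  simp only [hs₁, sub_self, map_zero, sub_zero, sub_sub_cancel] at h
  rw [add_sub_assoc, ← hR]
  exact sub_eq_iff_eq_add.mp h
end
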